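/- arXiv:2503.22073 — 15 statements merged into one kernel-verified Lean document; each statement's English description precedes it below -/
import Mathlib

section
/- The three lines D₀M_d, E₀M_e, F₀M_f are concurrent at the point Q = K(P'): that is, Q lies on the line through D₀ and M_d, on the line through E₀ and M_e, and on the line through F₀ and M_f. -/
/-- In a real vector space, the isotomcomplement of the point with barycentric coordinates
`x : y : z` lies on the line through the midpoint of `BC` and the midpoint of the cevian
from `A`. -/
lemma isotomcomplement_mem_line_midpoint_side_midpoint_cevian
    {V : Type*} [AddCommGroup V] [Module ℝ V] {A B C G P' : V} {x y z σ : ℝ}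
    (hG : G = (3 : ℝ)⁻¹ • (A + B + C))
    (hyz : y + z ≠ 0) (hσdef : σ = x * y + y * z + z * x) (hσ : σ ≠ 0)
    (hP' : P' = σ⁻¹ • ((y * z) • A + (z * x) • B + (x * y) • C)) :
    AffineMap.homothety G (-(1 / 2) : ℝ) P' ∈
      line[ℝ, midpoint ℝ B C, midpoint ℝ A ((y + z)⁻¹ • (y • B + z • C))] := by
  convert AffineMap.lineMap_mem_affineSpan_pair (x * (y + z) / σ)
    (midpoint ℝ B C) (midpoint ℝ A ((y + z)⁻¹ • (y • B + z • C))) using 1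
  simp only [hG, hP', AffineMap.homothety_apply, AffineMap.lineMap_apply, midpoint_eq_smul_add,
    vsub_eq_sub, vadd_eq_add, invOf_eq_inv]
  match_scalars <;> field_simp <;> rw [hσdef] <;> ring

/-- **Theorem 2.1 (Grinberg).** The lines `D₀M_d`, `E₀M_e`, `F₀M_f` joining the midpoints of
the sides of `ABC` to the midpoints of the cevians `AD`, `BE`, `CF` of `P` are concurrent
at the isotomcomplement `Q = K(P')` of `P`. -/
theorem cevian_midpoint_lines_concurrent_at_isotomcomplement
    (A B C G P P' Q D E F D₀ E₀ F₀ Md Me Mf : EuclideanSpace ℝ (Fin 2))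
    (x y z σ : ℝ)
    (hABC : AffineIndependent ℝ ![A, B, C])
    (hG : G = (3 : ℝ)⁻¹ • (A + B + C))
    (hsum : x + y + z = 1)
    (hx : x ≠ 0) (hy : y ≠ 0) (hz : z ≠ 0)
    (hyz : y + z ≠ 0) (hzx : z + x ≠ 0) (hxy : x + y ≠ 0)
    (hP : P = x • A + y • B + z • C)
    (hD : D = (y + z)⁻¹ • (y • B + z • C))
    (hE : E = (z + x)⁻¹ • (z • C + x • A))
    (hF : F = (x + y)⁻¹ • (x • A + y • B))
    (hD₀ : D₀ = midpoint ℝ B C) (hE₀ : E₀ = midpoint ℝ C A) (hF₀ : F₀ = midpoint ℝ A B)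
    (hMd : Md = midpoint ℝ A D) (hMe : Me = midpoint ℝ B E) (hMf : Mf = midpoint ℝ C F)
    (hσdef : σ = x * y + y * z + z * x) (hσ : σ ≠ 0)
    (hP' : P' = σ⁻¹ • ((y * z) • A + (z * x) • B + (x * y) • C))
    (hQ : Q = AffineMap.homothety G (-(1 / 2) : ℝ) P') :
    Q ∈ line[ℝ, D₀, Md] ∧ Q ∈ line[ℝ, E₀, Me] ∧ Q ∈ line[ℝ, F₀, Mf] := by
  subst hD hE hF hD₀ hE₀ hF₀ hMd hMe hMf hQ
  exact ⟨isotomcomplement_mem_line_midpoint_side_midpoint_cevian hG hyz hσdef hσ hP',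
    isotomcomplement_mem_line_midpoint_side_midpoint_cevian (x := y) (y := z) (z := x)
      (hG.trans (by module)) hzx (hσdef.trans (by ring)) hσ (hP'.trans (by module)),
    isotomcomplement_mem_line_midpoint_side_midpoint_cevian (x := z) (y := x) (z := y)
      (hG.trans (by module)) hxy (hσdef.trans (by ring)) hσ (hP'.trans (by module))⟩
end

section
/- The line through D₀ and Q is parallel to the line through A and P'; equivalently the vector Q -ᵥ D₀ is a nonzero scalar multiple of the vector P' -ᵥ A (both vectors being nonzero). -/
/-- **Corollary 2.2 (first part).** The line `D₀Q` is parallel to the line `AP'`: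
the vector `Q -ᵥ D₀` is a nonzero scalar multiple of `P' -ᵥ A`, both vectors being
nonzero. -/
theorem isotomcomplement_line_parallel
    (A B C G P P' Q D₀ : EuclideanSpace ℝ (Fin 2))
    (x y z σ : ℝ)
    (hABC : AffineIndependent ℝ ![A, B, C])
    (hG : G = (3 : ℝ)⁻¹ • (A + B + C))
    (hsum : x + y + z = 1)
    (hx : x ≠ 0) (hy : y ≠ 0) (hz : z ≠ 0)
    (hyz : y + z ≠ 0) (hzx : z + x ≠ 0) (hxy : x + y ≠ 0)
    (hP : P = x • A + y • B + z • C)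
    (hD₀ : D₀ = midpoint ℝ B C)
    (hσdef : σ = x * y + y * z + z * x) (hσ : σ ≠ 0)
    (hP' : P' = σ⁻¹ • ((y * z) • A + (z * x) • B + (x * y) • C))
    (hQ : Q = AffineMap.homothety G (-(1 / 2) : ℝ) P') :
    Q -ᵥ D₀ ≠ 0 ∧ P' -ᵥ A ≠ 0 ∧ ∃ t : ℝ, t ≠ 0 ∧ Q -ᵥ D₀ = t • (P' -ᵥ A) := by
  have hvec : Q -ᵥ D₀ = (-(1 / 2) : ℝ) • (P' -ᵥ A) := by
    rw [hQ, hD₀, AffineMap.homothety_apply, midpoint_eq_smul_add, hG]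
    simp only [vsub_eq_sub, vadd_eq_add, invOf_eq_inv]
    module
  have hne : P' -ᵥ A ≠ 0 := by
    intro h
    have hcomb : (y * z - σ) • A + (z * x) • B + (x * y) • C = 0 := by
      have hA : (y * z) • A + (z * x) • B + (x * y) • C = σ • A := by
        rw [← congrArg (σ • ·) (vsub_eq_zero_iff_eq.mp h), hP', smul_inv_smul₀ hσ]
      rw [sub_smul, ← hA]
      module
    have hweights := affineIndependent_iff.mp hABC Finset.univ ![y * z - σ, z * x, x * y]
      (by simp [Fin.sum_univ_three, hσdef]; ring)
      (by simpa [Fin.sum_univ_three] using hcomb) 1 (Finset.mem_univ _)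
    exact mul_ne_zero hz hx (by simpa using hweights)
  have ht : (-(1 / 2) : ℝ) ≠ 0 := by norm_num
  exact ⟨hvec ▸ smul_ne_zero ht hne, hne, _, ht, hvec⟩
end

section
/- The complement map K sends D₃ to M_d: K(D₃) = M_d, where M_d is the midpoint of segment AD and D₃ is the point reflection of D in D₀. -/
/-- **Corollary 2.2 (second part).** The complement map `K` (homothety about the centroid
with ratio `-1/2`) sends `D₃`, the reflection of the cevian trace `D` in the midpoint `D₀`
of `BC`, to the midpoint `M_d` of `AD`. -/
theorem complement_of_isotomic_trace_eq_cevian_midpoint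
    (A B C G P D D₀ D₃ Md : EuclideanSpace ℝ (Fin 2))
    (x y z : ℝ)
    (hABC : AffineIndependent ℝ ![A, B, C])
    (hG : G = (3 : ℝ)⁻¹ • (A + B + C))
    (hsum : x + y + z = 1)
    (hx : x ≠ 0) (hy : y ≠ 0) (hz : z ≠ 0)
    (hyz : y + z ≠ 0) (hzx : z + x ≠ 0) (hxy : x + y ≠ 0)
    (hP : P = x • A + y • B + z • C)
    (hD : D = (y + z)⁻¹ • (y • B + z • C))
    (hD₀ : D₀ = midpoint ℝ B C)
    (hMd : Md = midpoint ℝ A D)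
    (hD₃ : D₃ = Equiv.pointReflection D₀ D) :
    AffineMap.homothety G (-(1 / 2) : ℝ) D₃ = Md := by
  rw [hMd, hD₃, hD₀, hG, AffineMap.homothety_apply, Equiv.pointReflection_apply,
    midpoint_eq_smul_add, midpoint_eq_smul_add]
  simp only [vsub_eq_sub, vadd_eq_add, invOf_eq_inv]
  module
end

section
/- The three lines AA₀, BB₀, CC₀ are concurrent at the point Q = K(P'): that is, Q lies on the line through A and A₀, on the line through B and B₀, and on the line through C and C₀. -/
/-- The point with homogeneous barycentric coordinates `(x (y + z) : y (z + x) : z (x + y))` lies on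
the line joining `A` to the midpoint of the traces on `CA` and `AB` of the cevians of the point
`(x : y : z)`. -/
theorem isotomcomplement_mem_line_vertex_midpoint_traces {V : Type*} [AddCommGroup V]
    [Module ℝ V] (A B C : V) {x y z σ : ℝ} (hzx : z + x ≠ 0)
    (hxy : x + y ≠ 0) (hσdef : σ = x * y + y * z + z * x) (hσ : σ ≠ 0) :
    (2 * σ)⁻¹ • ((x * (y + z)) • A + (y * (z + x)) • B + (z * (x + y)) • C) ∈
      line[ℝ, A, midpoint ℝ ((z + x)⁻¹ • (z • C + x • A)) ((x + y)⁻¹ • (x • A + y • B))] := by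
  convert AffineMap.lineMap_mem_affineSpan_pair ((x + y) * (z + x) / σ) A _ using 1
  rw [AffineMap.lineMap_apply_module, midpoint_eq_smul_add, invOf_eq_inv]
  match_scalars <;> field_simp <;> rw [hσdef] <;> ring

/-- The isotomcomplement of `(x : y : z)` has homogeneous barycentric coordinates
`(x (y + z) : y (z + x) : z (x + y))`. -/
theorem homothety_centroid_isotomic_conjugate {V : Type*} [AddCommGroup V]
    [Module ℝ V] (A B C : V) {x y z σ : ℝ} (hσdef : σ = x * y + y * z + z * x) (hσ : σ ≠ 0) :
    AffineMap.homothety ((3 : ℝ)⁻¹ • (A + B + C)) (-(1 / 2) : ℝ)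
        (σ⁻¹ • ((y * z) • A + (z * x) • B + (x * y) • C)) =
      (2 * σ)⁻¹ • ((x * (y + z)) • A + (y * (z + x)) • B + (z * (x + y)) • C) := by
  rw [AffineMap.homothety_apply, vsub_eq_sub, vadd_eq_add]
  match_scalars <;> field_simp <;> rw [hσdef] <;> ring

/-- **Theorem 2.3 (Grinberg–Yiu).** The lines `AA₀`, `BB₀`, `CC₀` joining the vertices of
`ABC` to the midpoints of the sides of the cevian triangle `DEF` of `P` are concurrent at
the isotomcomplement `Q = K(P')` of `P`. -/
theorem vertex_cevian_midpoint_lines_concurrent_at_isotomcomplement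
    (A B C G P P' Q D E F A₀ B₀ C₀ : EuclideanSpace ℝ (Fin 2))
    (x y z σ : ℝ)
    (hABC : AffineIndependent ℝ ![A, B, C])
    (hG : G = (3 : ℝ)⁻¹ • (A + B + C))
    (hsum : x + y + z = 1)
    (hx : x ≠ 0) (hy : y ≠ 0) (hz : z ≠ 0)
    (hyz : y + z ≠ 0) (hzx : z + x ≠ 0) (hxy : x + y ≠ 0)
    (hP : P = x • A + y • B + z • C)
    (hD : D = (y + z)⁻¹ • (y • B + z • C))
    (hE : E = (z + x)⁻¹ • (z • C + x • A))
    (hF : F = (x + y)⁻¹ • (x • A + y • B))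
    (hA₀ : A₀ = midpoint ℝ E F) (hB₀ : B₀ = midpoint ℝ D F) (hC₀ : C₀ = midpoint ℝ D E)
    (hσdef : σ = x * y + y * z + z * x) (hσ : σ ≠ 0)
    (hP' : P' = σ⁻¹ • ((y * z) • A + (z * x) • B + (x * y) • C))
    (hQ : Q = AffineMap.homothety G (-(1 / 2) : ℝ) P') :
    Q ∈ line[ℝ, A, A₀] ∧ Q ∈ line[ℝ, B, B₀] ∧ Q ∈ line[ℝ, C, C₀] := by
  subst hG hP' hD hE hF hA₀ hB₀ hC₀
  rw [homothety_centroid_isotomic_conjugate A B C hσdef hσ] at hQ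
  subst hQ
  refine ⟨isotomcomplement_mem_line_vertex_midpoint_traces A B C hzx hxy hσdef hσ, ?_, ?_⟩
  · rw [midpoint_comm]
    convert isotomcomplement_mem_line_vertex_midpoint_traces B C A hxy hyz
      (by rw [hσdef]; ring) hσ using 1
    module
  · convert isotomcomplement_mem_line_vertex_midpoint_traces C A B hyz hzx
      (by rw [hσdef]; ring) hσ using 1
    module
end

section
/- The quadrilateral A₀E₀A₀'F₀ is a parallelogram; in particular the midpoint of segment A₀A₀' equals the midpoint of segment E₀F₀, and both equal N₁ = midpoint of AD₀. -/
/-- `A₀E₀A₀'F₀` is a parallelogram; in particular the midpoint of `A₀A₀'` equals the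
midpoint of `E₀F₀`, and both equal `N₁ = midpoint of AD₀`. -/
theorem parallelogram_A₀E₀A₀'F₀
    (A B C P D E F D₀ E₀ F₀ E₃ F₃ A₀ A₀' N₁ : EuclideanSpace ℝ (Fin 2))
    (x y z : ℝ)
    (hABC : AffineIndependent ℝ ![A, B, C])
    (hsum : x + y + z = 1)
    (hx : x ≠ 0) (hy : y ≠ 0) (hz : z ≠ 0)
    (hyz : y + z ≠ 0) (hzx : z + x ≠ 0) (hxy : x + y ≠ 0)
    (hP : P = x • A + y • B + z • C)
    (hD : D = (y + z)⁻¹ • (y • B + z • C))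
    (hE : E = (z + x)⁻¹ • (z • C + x • A))
    (hF : F = (x + y)⁻¹ • (x • A + y • B))
    (hD₀ : D₀ = midpoint ℝ B C) (hE₀ : E₀ = midpoint ℝ C A) (hF₀ : F₀ = midpoint ℝ A B)
    (hE₃ : E₃ = Equiv.pointReflection E₀ E)
    (hF₃ : F₃ = Equiv.pointReflection F₀ F)
    (hA₀ : A₀ = midpoint ℝ E F) (hA₀' : A₀' = midpoint ℝ E₃ F₃)
    (hN₁ : N₁ = midpoint ℝ A D₀) :
    E₀ -ᵥ A₀ = A₀' -ᵥ F₀ ∧ midpoint ℝ A₀ A₀' = midpoint ℝ E₀ F₀ ∧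
      midpoint ℝ E₀ F₀ = N₁ := by
  subst hD₀ hE₀ hF₀ hE₃ hF₃ hA₀ hA₀' hN₁
  simp only [midpoint_eq_smul_add, Equiv.pointReflection_apply, vsub_eq_sub, vadd_eq_add,
    invOf_eq_inv]
  refine ⟨?_, ?_, ?_⟩ <;> module
end

section
/- The three points D₀, R, and A₀ are collinear, where D₀ is the midpoint of BC, R is the midpoint of AP, and A₀ is the midpoint of EF. -/
/-- The midpoint `D₀` of `BC`, the midpoint `R` of `AP`, and the midpoint `A₀` of `EF`
are collinear. -/
theorem midpoints_D₀_R_A₀_collinear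
    (A B C P D E F D₀ R A₀ : EuclideanSpace ℝ (Fin 2))
    (x y z : ℝ)
    (hABC : AffineIndependent ℝ ![A, B, C])
    (hsum : x + y + z = 1)
    (hx : x ≠ 0) (hy : y ≠ 0) (hz : z ≠ 0)
    (hyz : y + z ≠ 0) (hzx : z + x ≠ 0) (hxy : x + y ≠ 0)
    (hP : P = x • A + y • B + z • C)
    (hD : D = (y + z)⁻¹ • (y • B + z • C))
    (hE : E = (z + x)⁻¹ • (z • C + x • A))
    (hF : F = (x + y)⁻¹ • (x • A + y • B))
    (hD₀ : D₀ = midpoint ℝ B C)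
    (hR : R = midpoint ℝ A P)
    (hA₀ : A₀ = midpoint ℝ E F) :
    Collinear ℝ ({D₀, R, A₀} : Set (EuclideanSpace ℝ (Fin 2))) := by
  have hA₀_eq : A₀ = (y * z * ((x + y)⁻¹ * (z + x)⁻¹)) • (D₀ - R) + R := by
    subst hA₀ hR hD₀ hF hE hP
    obtain rfl : x = 1 - y - z := by linarith
    ext i
    simp only [midpoint_eq_smul_add, PiLp.add_apply, PiLp.sub_apply, PiLp.smul_apply, smul_eq_mul,
      invOf_eq_inv]
    field_simp
    ring
  rw [collinear_iff_of_mem (p₀ := R) (by simp)]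
  refine ⟨D₀ - R, ?_⟩
  simp only [Set.mem_insert_iff, Set.mem_singleton_iff, forall_eq_or_imp, forall_eq, vadd_eq_add]
  exact ⟨⟨1, by simp⟩, ⟨0, by simp⟩, ⟨_, hA₀_eq⟩⟩
end

section
/- The quadrilateral M_dQ'M_d'R is a parallelogram: Q' -ᵥ M_d = M_d' -ᵥ R (so M_dQ' is parallel to RM_d' and Q'M_d' is parallel to M_dR), and its diagonals M_dM_d' and Q'R bisect each other at N₁ = midpoint of AD₀. -/
/-- `M_dQ'M_d'R` is a parallelogram (`Q' -ᵥ M_d = M_d' -ᵥ R`), and its diagonals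
`M_dM_d'` and `Q'R` bisect each other at `N₁ = midpoint of AD₀`. -/
theorem parallelogram_Md_Q'_Md'_R
    (A B C G P D D₀ D₃ Q' Md Md' R N₁ : EuclideanSpace ℝ (Fin 2))
    (x y z : ℝ)
    (hABC : AffineIndependent ℝ ![A, B, C])
    (hG : G = (3 : ℝ)⁻¹ • (A + B + C))
    (hsum : x + y + z = 1)
    (hx : x ≠ 0) (hy : y ≠ 0) (hz : z ≠ 0)
    (hyz : y + z ≠ 0) (hzx : z + x ≠ 0) (hxy : x + y ≠ 0)
    (hP : P = x • A + y • B + z • C)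
    (hD : D = (y + z)⁻¹ • (y • B + z • C))
    (hD₀ : D₀ = midpoint ℝ B C)
    (hD₃ : D₃ = Equiv.pointReflection D₀ D)
    (hQ' : Q' = AffineMap.homothety G (-(1 / 2) : ℝ) P)
    (hMd : Md = midpoint ℝ A D) (hMd' : Md' = midpoint ℝ A D₃)
    (hR : R = midpoint ℝ A P)
    (hN₁ : N₁ = midpoint ℝ A D₀) :
    Q' -ᵥ Md = Md' -ᵥ R ∧ midpoint ℝ Md Md' = N₁ ∧ midpoint ℝ Q' R = N₁ := by
  subst hMd hMd' hR hN₁ hQ' hD₃ hD₀ hG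
  simp only [midpoint_eq_smul_add, AffineMap.homothety_apply, Equiv.pointReflection_apply,
    vsub_eq_sub, vadd_eq_add, invOf_eq_inv]
  refine ⟨?_, ?_, ?_⟩ <;> module
end

section
/- The Euclidean quadrilaterals RA₀QM_d and Q'A₀'R'M_d' are congruent under the correspondence R ↦ Q', A₀ ↦ A₀', Q ↦ R', M_d ↦ M_d'; in particular dist(R, A₀) = dist(Q', A₀'), dist(A₀, Q) = dist(A₀', R'), dist(Q, M_d) = dist(R', M_d'), dist(M_d, R) = dist(M_d', Q'), dist(R, Q) = dist(Q', R'), and dist(A₀, M_d) = dist(A₀', M_d'). -/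
/-- Two pairs of points with the same sum, hence the same midpoint, are exchanged by a point
reflection, so the corresponding distances agree. -/
theorem dist_eq_dist_of_add_eq_add {V : Type*} [SeminormedAddCommGroup V] {p p' q q' : V}
    (h : p + p' = q + q') : dist p q = dist p' q' := by
  rw [dist_comm p', dist_eq_norm, dist_eq_norm, sub_eq_sub_iff_add_eq_add.mpr (h.trans (add_comm q q'))]


/-- **Corollary 2.4 a).** The quadrilaterals `RA₀QM_d` and `Q'A₀'R'M_d'` are congruent
under the correspondence `R ↦ Q'`, `A₀ ↦ A₀'`, `Q ↦ R'`, `M_d ↦ M_d'`. -/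
theorem congruent_quadrilaterals
    (A B C G P P' Q Q' D E F D₀ E₀ F₀ D₃ E₃ F₃ Md Md' R R' A₀ A₀' :
      EuclideanSpace ℝ (Fin 2))
    (x y z σ : ℝ)
    (hABC : AffineIndependent ℝ ![A, B, C])
    (hG : G = (3 : ℝ)⁻¹ • (A + B + C))
    (hsum : x + y + z = 1)
    (hx : x ≠ 0) (hy : y ≠ 0) (hz : z ≠ 0)
    (hyz : y + z ≠ 0) (hzx : z + x ≠ 0) (hxy : x + y ≠ 0)
    (hP : P = x • A + y • B + z • C)
    (hD : D = (y + z)⁻¹ • (y • B + z • C))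
    (hE : E = (z + x)⁻¹ • (z • C + x • A))
    (hF : F = (x + y)⁻¹ • (x • A + y • B))
    (hD₀ : D₀ = midpoint ℝ B C) (hE₀ : E₀ = midpoint ℝ C A) (hF₀ : F₀ = midpoint ℝ A B)
    (hσdef : σ = x * y + y * z + z * x) (hσ : σ ≠ 0)
    (hP' : P' = σ⁻¹ • ((y * z) • A + (z * x) • B + (x * y) • C))
    (hD₃ : D₃ = Equiv.pointReflection D₀ D)
    (hE₃ : E₃ = Equiv.pointReflection E₀ E)
    (hF₃ : F₃ = Equiv.pointReflection F₀ F)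
    (hQ : Q = AffineMap.homothety G (-(1 / 2) : ℝ) P')
    (hQ' : Q' = AffineMap.homothety G (-(1 / 2) : ℝ) P)
    (hMd : Md = midpoint ℝ A D) (hMd' : Md' = midpoint ℝ A D₃)
    (hR : R = midpoint ℝ A P) (hR' : R' = midpoint ℝ A P')
    (hA₀ : A₀ = midpoint ℝ E F) (hA₀' : A₀' = midpoint ℝ E₃ F₃) :
    dist R A₀ = dist Q' A₀' ∧ dist A₀ Q = dist A₀' R' ∧ dist Q Md = dist R' Md' ∧
      dist Md R = dist Md' Q' ∧ dist R Q = dist Q' R' ∧ dist A₀ Md = dist A₀' Md' := by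
  have homothety_eq (X : EuclideanSpace ℝ (Fin 2)) :
      AffineMap.homothety G (-(1 / 2) : ℝ) X = (2 : ℝ)⁻¹ • (A + B + C - X) := by
    rw [AffineMap.homothety_apply, vsub_eq_sub, vadd_eq_add, hG]
    module
  have h_R : R + Q' = A + (2 : ℝ)⁻¹ • (B + C) := by
    rw [hR, hQ', homothety_eq, midpoint_eq_smul_add, invOf_eq_inv]
    module
  have h_Q : Q + R' = A + (2 : ℝ)⁻¹ • (B + C) := by
    rw [hR', hQ, homothety_eq, midpoint_eq_smul_add, invOf_eq_inv]
    module
  have h_Md : Md + Md' = A + (2 : ℝ)⁻¹ • (B + C) := by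
    simp only [hMd, hMd', hD₃, hD₀, midpoint_eq_smul_add, invOf_eq_inv,
      Equiv.pointReflection_apply, vsub_eq_sub, vadd_eq_add]
    module
  have h_A₀ : A₀ + A₀' = A + (2 : ℝ)⁻¹ • (B + C) := by
    simp only [hA₀, hA₀', hE₃, hF₃, hE₀, hF₀, midpoint_eq_smul_add, invOf_eq_inv,
      Equiv.pointReflection_apply, vsub_eq_sub, vadd_eq_add]
    module
  exact ⟨dist_eq_dist_of_add_eq_add (h_R.trans h_A₀.symm),
    dist_eq_dist_of_add_eq_add (h_A₀.trans h_Q.symm),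
    dist_eq_dist_of_add_eq_add (h_Q.trans h_Md.symm),
    dist_eq_dist_of_add_eq_add (h_Md.trans h_R.symm),
    dist_eq_dist_of_add_eq_add (h_R.trans h_Q.symm),
    dist_eq_dist_of_add_eq_add (h_A₀.trans h_Md.symm)⟩
end

section
/- The four points D₀, R, A₀, and M = K(Q') are collinear, and moreover M = K(Q') is the midpoint of segment D₀R. -/
/-- **Corollary 2.4 b).** The points `D₀`, `R`, `A₀`, and `M = K(Q')` are collinear, and
`M` is the midpoint of segment `D₀R`. -/
theorem collinear_D₀_R_A₀_M_and_M_midpoint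
    (A B C G P D E F D₀ R A₀ Q' M : EuclideanSpace ℝ (Fin 2))
    (x y z : ℝ)
    (hABC : AffineIndependent ℝ ![A, B, C])
    (hG : G = (3 : ℝ)⁻¹ • (A + B + C))
    (hsum : x + y + z = 1)
    (hx : x ≠ 0) (hy : y ≠ 0) (hz : z ≠ 0)
    (hyz : y + z ≠ 0) (hzx : z + x ≠ 0) (hxy : x + y ≠ 0)
    (hP : P = x • A + y • B + z • C)
    (hD : D = (y + z)⁻¹ • (y • B + z • C))
    (hE : E = (z + x)⁻¹ • (z • C + x • A))
    (hF : F = (x + y)⁻¹ • (x • A + y • B))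
    (hD₀ : D₀ = midpoint ℝ B C)
    (hR : R = midpoint ℝ A P)
    (hA₀ : A₀ = midpoint ℝ E F)
    (hQ' : Q' = AffineMap.homothety G (-(1 / 2) : ℝ) P)
    (hM : M = AffineMap.homothety G (-(1 / 2) : ℝ) Q') :
    Collinear ℝ ({D₀, R, A₀, M} : Set (EuclideanSpace ℝ (Fin 2))) ∧
      M = midpoint ℝ D₀ R := by
  have hm : M = midpoint ℝ D₀ R := by
    subst hM hQ' hR hD₀ hG
    simp only [AffineMap.homothety_apply, midpoint_eq_smul_add, vsub_eq_sub, vadd_eq_add,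
      invOf_eq_inv]
    module
  refine ⟨?_, hm⟩
  have hA : A₀ = (x / ((x + y) * (z + x))) • (R - D₀) + D₀ := by
    obtain rfl : z = 1 - x - y := by linarith
    subst hA₀ hR hD₀ hE hF hP
    ext i
    simp only [midpoint_eq_smul_add, invOf_eq_inv, PiLp.add_apply, PiLp.sub_apply,
      PiLp.smul_apply, smul_eq_mul]
    field_simp
    ring
  rw [collinear_iff_of_mem (p₀ := D₀) (by simp)]
  refine ⟨R - D₀, ?_⟩
  simp only [Set.mem_insert_iff, Set.mem_singleton_iff, vadd_eq_add]
  rintro p (rfl | rfl | rfl | rfl)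
  · exact ⟨0, by simp⟩
  · exact ⟨1, by simp⟩
  · exact ⟨_, hA⟩
  · refine ⟨1 / 2, ?_⟩
    rw [hm, midpoint_eq_smul_add, invOf_eq_inv]
    module
end

section
/- (Existence of the generalized circumcenter) The point O = T⁻¹(K(Q)) satisfies the defining conditions of the generalized circumcenter of P: the vector O -ᵥ D₀ is a scalar multiple of Q -ᵥ D, the vector O -ᵥ E₀ is a scalar multiple of Q -ᵥ E, and the vector O -ᵥ F₀ is a scalar multiple of Q -ᵥ F (so line OD₀ is parallel to line QD, OE₀ to QE, and OF₀ to QF). -/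
/-- An affine map between vector spaces commutes with affine combinations of three points. -/
theorem AffineMap.map_smul_add_smul_add_smul {k V W : Type*} [CommRing k] [AddCommGroup V] [Module k V]
    [AddCommGroup W] [Module k W] (f : V →ᵃ[k] W) (A B C : V) {a b c : k} (h : a + b + c = 1) :
    f (a • A + b • B + c • C) = a • f A + b • f B + c • f C := by
  obtain rfl : c = 1 - a - b := by rw [← h]; abel
  have key : a • A + b • B + (1 - a - b) • C = (a • (A - C) + b • (B - C)) +ᵥ C := by
    rw [vadd_eq_add]; module
  rw [key, f.map_vadd, map_add, map_smul, map_smul, ← vsub_eq_sub A C, ← vsub_eq_sub B C,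
    f.linearMap_vsub, f.linearMap_vsub, vsub_eq_sub, vsub_eq_sub, vadd_eq_add]
  module


/-- **Theorem 3.2 (circumcenter part).** The point `O = T_{P'}⁻¹(K(Q))` satisfies the
defining conditions of the generalized circumcenter of `P`: `OD₀ ∥ QD`, `OE₀ ∥ QE`,
`OF₀ ∥ QF`. -/
theorem generalized_circumcenter_exists
    (A B C G P P' Q D E F D₀ E₀ F₀ D₃ E₃ F₃ : EuclideanSpace ℝ (Fin 2))
    (x y z σ : ℝ)
    (hABC : AffineIndependent ℝ ![A, B, C])
    (hG : G = (3 : ℝ)⁻¹ • (A + B + C))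
    (hsum : x + y + z = 1)
    (hx : x ≠ 0) (hy : y ≠ 0) (hz : z ≠ 0)
    (hyz : y + z ≠ 0) (hzx : z + x ≠ 0) (hxy : x + y ≠ 0)
    (hP : P = x • A + y • B + z • C)
    (hD : D = (y + z)⁻¹ • (y • B + z • C))
    (hE : E = (z + x)⁻¹ • (z • C + x • A))
    (hF : F = (x + y)⁻¹ • (x • A + y • B))
    (hD₀ : D₀ = midpoint ℝ B C) (hE₀ : E₀ = midpoint ℝ C A) (hF₀ : F₀ = midpoint ℝ A B)
    (hσdef : σ = x * y + y * z + z * x) (hσ : σ ≠ 0)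
    (hP' : P' = σ⁻¹ • ((y * z) • A + (z * x) • B + (x * y) • C))
    (hD₃ : D₃ = Equiv.pointReflection D₀ D)
    (hE₃ : E₃ = Equiv.pointReflection E₀ E)
    (hF₃ : F₃ = Equiv.pointReflection F₀ F)
    (hD₃E₃F₃ : AffineIndependent ℝ ![D₃, E₃, F₃])
    (hQ : Q = AffineMap.homothety G (-(1 / 2) : ℝ) P')
    (T : EuclideanSpace ℝ (Fin 2) ≃ᵃ[ℝ] EuclideanSpace ℝ (Fin 2))
    (hTA : T A = D₃) (hTB : T B = E₃) (hTC : T C = F₃)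
    (O : EuclideanSpace ℝ (Fin 2))
    (hO : O = T.symm (AffineMap.homothety G (-(1 / 2) : ℝ) Q)) :
    (∃ t : ℝ, O -ᵥ D₀ = t • (Q -ᵥ D)) ∧ (∃ t : ℝ, O -ᵥ E₀ = t • (Q -ᵥ E)) ∧
      (∃ t : ℝ, O -ᵥ F₀ = t • (Q -ᵥ F)) := by
  set a : ℝ := (y + z) * (σ * (y + z - x) + x * y * z) / (8 * σ * (y * z)) with ha
  set b : ℝ := (z + x) * (σ * (z + x - y) + x * y * z) / (8 * σ * (z * x)) with hb
  set c : ℝ := (x + y) * (σ * (x + y - z) + x * y * z) / (8 * σ * (x * y)) with hc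
  have habc : a + b + c = 1 := by
    rw [ha, hb, hc]
    field_simp
    rw [hσdef]
    ring
  have hTO : T (a • A + b • B + c • C) = AffineMap.homothety G (-(1 / 2) : ℝ) Q := by
    have h := T.toAffineMap.map_smul_add_smul_add_smul A B C habc
    simp only [AffineEquiv.coe_toAffineMap] at h
    rw [h, hTA, hTB, hTC, hD₃, hE₃, hF₃, hQ, hP', hD₀, hE₀, hF₀, hD, hE, hF, hG]
    ext i
    simp only [AffineMap.homothety_apply, Equiv.pointReflection_apply, midpoint_eq_smul_add,
      vsub_eq_sub, vadd_eq_add, PiLp.add_apply, PiLp.sub_apply, PiLp.smul_apply, smul_eq_mul,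
      invOf_eq_inv]
    rw [ha, hb, hc]
    field_simp
    rw [hσdef]
    ring
  have hO' : O = a • A + b • B + c • C := by
    rw [hO, ← hTO, T.symm_apply_apply]
  refine ⟨⟨(σ * (y + z - x) + x * y * z) / (4 * (x * y * z)), ?_⟩,
    ⟨(σ * (z + x - y) + x * y * z) / (4 * (x * y * z)), ?_⟩,
    ⟨(σ * (x + y - z) + x * y * z) / (4 * (x * y * z)), ?_⟩⟩
  all_goals
    rw [hO', hQ, hP', hG]
    first | rw [hD₀, hD] | rw [hE₀, hE] | rw [hF₀, hF]
    ext i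
    simp only [AffineMap.homothety_apply, midpoint_eq_smul_add, vsub_eq_sub, vadd_eq_add,
      PiLp.add_apply, PiLp.sub_apply, PiLp.smul_apply, smul_eq_mul, invOf_eq_inv]
    rw [ha, hb, hc]
    field_simp
    rw [hσdef]
    ring
end

section
/- (Existence of the generalized orthocenter) The point H = K⁻¹(T⁻¹(K(Q))) satisfies the defining conditions of the generalized orthocenter of P: the vector H -ᵥ A is a scalar multiple of Q -ᵥ D, the vector H -ᵥ B is a scalar multiple of Q -ᵥ E, and the vector H -ᵥ C is a scalar multiple of Q -ᵥ F (so line HA is parallel to line QD, HB to QE, and HC to QF). -/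
/-- An affine map sends `u • A + v • B + w • C` with `u + v + w = 1` to the same combination
of the images. -/
theorem AffineEquiv.map_add_smul_of_sum_eq_one {V W : Type*} [AddCommGroup V] [Module ℝ V]
    [AddCommGroup W] [Module ℝ W] (T : V ≃ᵃ[ℝ] W) (A B C : V) {u v w : ℝ} (h : u + v + w = 1) :
    T (u • A + v • B + w • C) = u • T A + v • T B + w • T C := by
  have hT (X : V) : T X = T.linear X + T 0 := by
    simpa using T.map_vadd 0 X
  obtain rfl : u = 1 - v - w := by linarith
  rw [hT, hT A, hT B, hT C]
  simp only [map_add, map_smul]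
  module

/-- **Theorem 3.2 (orthocenter part).** The point `H = K⁻¹(T_{P'}⁻¹(K(Q)))` satisfies the
defining conditions of the generalized orthocenter of `P`: `HA ∥ QD`, `HB ∥ QE`,
`HC ∥ QF`. -/
theorem generalized_orthocenter_exists
    (A B C G P P' Q D E F D₀ E₀ F₀ D₃ E₃ F₃ : EuclideanSpace ℝ (Fin 2))
    (x y z σ : ℝ)
    (hABC : AffineIndependent ℝ ![A, B, C])
    (hG : G = (3 : ℝ)⁻¹ • (A + B + C))
    (hsum : x + y + z = 1)
    (hx : x ≠ 0) (hy : y ≠ 0) (hz : z ≠ 0)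
    (hyz : y + z ≠ 0) (hzx : z + x ≠ 0) (hxy : x + y ≠ 0)
    (hP : P = x • A + y • B + z • C)
    (hD : D = (y + z)⁻¹ • (y • B + z • C))
    (hE : E = (z + x)⁻¹ • (z • C + x • A))
    (hF : F = (x + y)⁻¹ • (x • A + y • B))
    (hD₀ : D₀ = midpoint ℝ B C) (hE₀ : E₀ = midpoint ℝ C A) (hF₀ : F₀ = midpoint ℝ A B)
    (hσdef : σ = x * y + y * z + z * x) (hσ : σ ≠ 0)
    (hP' : P' = σ⁻¹ • ((y * z) • A + (z * x) • B + (x * y) • C))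
    (hD₃ : D₃ = Equiv.pointReflection D₀ D)
    (hE₃ : E₃ = Equiv.pointReflection E₀ E)
    (hF₃ : F₃ = Equiv.pointReflection F₀ F)
    (hD₃E₃F₃ : AffineIndependent ℝ ![D₃, E₃, F₃])
    (hQ : Q = AffineMap.homothety G (-(1 / 2) : ℝ) P')
    (T : EuclideanSpace ℝ (Fin 2) ≃ᵃ[ℝ] EuclideanSpace ℝ (Fin 2))
    (hTA : T A = D₃) (hTB : T B = E₃) (hTC : T C = F₃)
    (H : EuclideanSpace ℝ (Fin 2))
    (hH : H = AffineMap.homothety G (-2 : ℝ)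
      (T.symm (AffineMap.homothety G (-(1 / 2) : ℝ) Q))) :
    (∃ t : ℝ, H -ᵥ A = t • (Q -ᵥ D)) ∧ (∃ t : ℝ, H -ᵥ B = t • (Q -ᵥ E)) ∧
      (∃ t : ℝ, H -ᵥ C = t • (Q -ᵥ F)) := by
  set k : ℝ := (8 * σ * x * y * z)⁻¹ with hk
  set u : ℝ := k * x * (y + z) ^ 2 * ((x + y) * (z + x) - 2 * x ^ 2) with hu
  set v : ℝ := k * y * (z + x) ^ 2 * ((y + z) * (x + y) - 2 * y ^ 2) with hv
  set w : ℝ := k * z * (x + y) ^ 2 * ((z + x) * (y + z) - 2 * z ^ 2) with hw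
  have huvw : u + v + w = 1 := by
    rw [hu, hv, hw, hk]
    field_simp
    rw [hσdef]
    ring
  have hQ' : Q = (2 * σ)⁻¹ • ((x * (y + z)) • A + (y * (z + x)) • B + (z * (x + y)) • C) := by
    rw [hQ, hG, hP', AffineMap.homothety_apply, vsub_eq_sub, vadd_eq_add]
    match_scalars <;> field_simp <;> rw [hσdef] <;> ring
  have hTQ : T (u • A + v • B + w • C) = AffineMap.homothety G (-(1 / 2) : ℝ) Q := by
    rw [T.map_add_smul_of_sum_eq_one A B C huvw, hTA, hTB, hTC, hD₃, hE₃, hF₃,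
      hD₀, hE₀, hF₀, hD, hE, hF, hG, hQ', AffineMap.homothety_apply]
    simp only [Equiv.pointReflection_apply, midpoint_eq_smul_add, vsub_eq_sub, vadd_eq_add,
      invOf_eq_inv]
    match_scalars <;> simp only [hu, hv, hw, hk] <;> field_simp <;> rw [hσdef] <;> ring
  have hH' : H = (1 - 2 * u) • A + (1 - 2 * v) • B + (1 - 2 * w) • C := by
    rw [hH, ← hTQ, T.symm_apply_apply, hG, AffineMap.homothety_apply, vsub_eq_sub, vadd_eq_add]
    module
  rw [hH', hQ', hD, hE, hF]
  simp only [vsub_eq_sub]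
  refine ⟨⟨-(y + z) * ((x + y) * (z + x) - 2 * x ^ 2) / (2 * x * y * z), ?_⟩,
    ⟨-(z + x) * ((y + z) * (x + y) - 2 * y ^ 2) / (2 * x * y * z), ?_⟩,
    ⟨-(x + y) * ((z + x) * (y + z) - 2 * z ^ 2) / (2 * x * y * z), ?_⟩⟩ <;>
  · match_scalars <;> simp only [hu, hv, hw, hk] <;> field_simp <;> rw [hσdef] <;> ring
end

section
/- The point reflection of D in Q lies on the line through A and D₃; that is, if T denotes the intersection of line DQ with line AD₃, then Q is the midpoint of segment DT. -/
/-- The point reflection of the cevian trace `D` in the isotomcomplement `Q` lies on the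
line through `A` and `D₃`; that is, if `T = DQ ∩ AD₃`, then `Q` is the midpoint of
segment `DT`. -/
theorem pointReflection_of_D_in_Q_mem_line_A_D₃
    (A B C G P P' Q D D₀ D₃ : EuclideanSpace ℝ (Fin 2))
    (x y z σ : ℝ)
    (hABC : AffineIndependent ℝ ![A, B, C])
    (hG : G = (3 : ℝ)⁻¹ • (A + B + C))
    (hsum : x + y + z = 1)
    (hx : x ≠ 0) (hy : y ≠ 0) (hz : z ≠ 0)
    (hyz : y + z ≠ 0) (hzx : z + x ≠ 0) (hxy : x + y ≠ 0)
    (hP : P = x • A + y • B + z • C)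
    (hD : D = (y + z)⁻¹ • (y • B + z • C))
    (hD₀ : D₀ = midpoint ℝ B C)
    (hD₃ : D₃ = Equiv.pointReflection D₀ D)
    (hσdef : σ = x * y + y * z + z * x) (hσ : σ ≠ 0)
    (hP' : P' = σ⁻¹ • ((y * z) • A + (z * x) • B + (x * y) • C))
    (hQ : Q = AffineMap.homothety G (-(1 / 2) : ℝ) P') :
    Equiv.pointReflection Q D ∈ line[ℝ, A, D₃] := by
  have hT : Equiv.pointReflection Q D = AffineMap.lineMap A D₃ (y * z / σ) := by
    have hcoeff : y * z / σ = 1 - x * (y + z) / σ := by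
      field_simp
      rw [hσdef]
      ring
    have hD₃' : D₃ = (y + z)⁻¹ • (z • B + y • C) := by
      ext i
      simp [hD₃, hD₀, hD, Equiv.pointReflection_apply, midpoint_eq_smul_add]
      field_simp
      ring
    have hP'' : P' = (y * z / σ) • A + (x * (y + z) / σ) • D₃ := by
      ext i
      simp [hP', hD₃']
      field_simp
      ring
    have hDD₃ : D + D₃ = B + C := by
      ext i
      simp [hD, hD₃']
      field_simp
      ring
    have hDi (i : Fin 2) : D i = B i + C i - D₃ i := by
      rw [eq_sub_iff_add_eq]
      exact congrArg (fun v : EuclideanSpace ℝ (Fin 2) => v i) hDD₃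
    ext i
    simp [hQ, hG, hP'', AffineMap.homothety_apply, AffineMap.lineMap_apply,
      Equiv.pointReflection_apply, hDi, hcoeff]
    ring
  rw [hT]
  exact AffineMap.lineMap_mem_affineSpan_pair _ _ _
end

section
/- (Barycentric coordinates of the generalized circumcenter) Set x'' = xy + xz + yz − x², y'' = xy + xz + yz − y², z'' = xy + xz + yz − z², and let w_A = x(y+z)²x'', w_B = y(x+z)²y'', w_C = z(x+y)²z'', with Σ = w_A + w_B + w_C. Then Σ ≠ 0 and the generalized circumcenter satisfies O = (w_A•A + w_B•B + w_C•C)/Σ (affine combination). -/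
/-- An affine map between modules preserves combinations whose weights sum to one. -/
theorem AffineMap.map_three_combination {k V W : Type*} [Ring k] [AddCommGroup V] [Module k V]
    [AddCommGroup W] [Module k W] (f : V →ᵃ[k] W) (u v w : V) {a b c : k}
    (h : a + b + c = 1) :
    f (a • u + b • v + c • w) = a • f u + b • f v + c • f w := by
  have hf (p : V) : f p = f.linear p + f 0 := congrFun f.decomp p
  have h0 : f 0 = a • f 0 + b • f 0 + c • f 0 := by rw [← add_smul, ← add_smul, h, one_smul]
  rw [hf (_ + _), hf u, hf v, hf w]
  simp only [map_add, map_smul, smul_add]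
  nth_rw 1 [h0]
  abel

/-- The isotomic conjugate of a point on the line through `u` and `v` has swapped weights. -/
theorem pointReflection_midpoint_weighted {k V : Type*} [Field k] [Invertible (2 : k)]
    [AddCommGroup V] [Module k V] (u v : V) {a b : k} (h : a + b ≠ 0) :
    Equiv.pointReflection (midpoint k u v) ((a + b)⁻¹ • (a • u + b • v))
      = (a + b)⁻¹ • (b • u + a • v) := by
  rw [Equiv.pointReflection_apply, vsub_eq_sub, vadd_eq_add, sub_add_eq_add_sub,
    midpoint_add_self, sub_eq_iff_eq_add, ← smul_add, eq_inv_smul_iff₀ h]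
  module

/-- **Barycentric coordinates of the generalized circumcenter.** With
`x'' = xy + xz + yz − x²` (etc.), `w_A = x(y+z)²x''`, `w_B = y(x+z)²y''`,
`w_C = z(x+y)²z''`, and `Σ = w_A + w_B + w_C`, one has `Σ ≠ 0` and
`O = (w_A•A + w_B•B + w_C•C)/Σ`. -/
theorem generalized_circumcenter_barycentric
    (A B C G P P' Q D E F D₀ E₀ F₀ D₃ E₃ F₃ : EuclideanSpace ℝ (Fin 2))
    (x y z σ : ℝ)
    (hABC : AffineIndependent ℝ ![A, B, C])
    (hG : G = (3 : ℝ)⁻¹ • (A + B + C))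
    (hsum : x + y + z = 1)
    (hx : x ≠ 0) (hy : y ≠ 0) (hz : z ≠ 0)
    (hyz : y + z ≠ 0) (hzx : z + x ≠ 0) (hxy : x + y ≠ 0)
    (hP : P = x • A + y • B + z • C)
    (hD : D = (y + z)⁻¹ • (y • B + z • C))
    (hE : E = (z + x)⁻¹ • (z • C + x • A))
    (hF : F = (x + y)⁻¹ • (x • A + y • B))
    (hD₀ : D₀ = midpoint ℝ B C) (hE₀ : E₀ = midpoint ℝ C A) (hF₀ : F₀ = midpoint ℝ A B)
    (hσdef : σ = x * y + y * z + z * x) (hσ : σ ≠ 0)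
    (hP' : P' = σ⁻¹ • ((y * z) • A + (z * x) • B + (x * y) • C))
    (hD₃ : D₃ = Equiv.pointReflection D₀ D)
    (hE₃ : E₃ = Equiv.pointReflection E₀ E)
    (hF₃ : F₃ = Equiv.pointReflection F₀ F)
    (hD₃E₃F₃ : AffineIndependent ℝ ![D₃, E₃, F₃])
    (hQ : Q = AffineMap.homothety G (-(1 / 2) : ℝ) P')
    (T : EuclideanSpace ℝ (Fin 2) ≃ᵃ[ℝ] EuclideanSpace ℝ (Fin 2))
    (hTA : T A = D₃) (hTB : T B = E₃) (hTC : T C = F₃)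
    (O : EuclideanSpace ℝ (Fin 2))
    (hO : O = T.symm (AffineMap.homothety G (-(1 / 2) : ℝ) Q))
    (x'' y'' z'' wA wB wC S : ℝ)
    (hx'' : x'' = x * y + x * z + y * z - x ^ 2)
    (hy'' : y'' = x * y + x * z + y * z - y ^ 2)
    (hz'' : z'' = x * y + x * z + y * z - z ^ 2)
    (hwA : wA = x * (y + z) ^ 2 * x'')
    (hwB : wB = y * (x + z) ^ 2 * y'')
    (hwC : wC = z * (x + y) ^ 2 * z'')
    (hS : S = wA + wB + wC) :
    S ≠ 0 ∧ O = S⁻¹ • (wA • A + wB • B + wC • C) := by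
  have hS_eq : S = 8 * (x * y * z) * σ := by
    subst hS hwA hwB hwC hx'' hy'' hz'' hσdef
    ring
  have hS0 : S ≠ 0 := by
    rw [hS_eq]
    simp [hx, hy, hz, hσ]
  refine ⟨hS0, ?_⟩
  have hweights : S⁻¹ * wA + S⁻¹ * wB + S⁻¹ * wC = 1 := by
    rw [← mul_add, ← mul_add, ← hS, inv_mul_cancel₀ hS0]
  have hT := T.toAffineMap.map_three_combination A B C hweights
  simp only [AffineEquiv.coe_toAffineMap, hTA, hTB, hTC] at hT
  rw [hD, hD₀, pointReflection_midpoint_weighted B C hyz] at hD₃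
  rw [hE, hE₀, pointReflection_midpoint_weighted C A hzx] at hE₃
  rw [hF, hF₀, pointReflection_midpoint_weighted A B hxy] at hF₃
  have hKQ : AffineMap.homothety G (-(1 / 2) : ℝ) Q = (4 : ℝ)⁻¹ • (A + B + C + P') := by
    rw [hQ, hG]
    simp only [AffineMap.homothety_apply, vsub_eq_sub, vadd_eq_add]
    module
  have hO_T : T O = (4 : ℝ)⁻¹ • (A + B + C + P') := by rw [hO, T.apply_symm_apply, hKQ]
  apply T.injective
  rw [hO_T, smul_add S⁻¹, smul_add S⁻¹, smul_smul, smul_smul, smul_smul, hT, hP', hD₃, hE₃, hF₃]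
  have hA : S⁻¹ * wB * ((z + x)⁻¹ * z) + S⁻¹ * wC * ((x + y)⁻¹ * y)
      = 4⁻¹ * (1 + σ⁻¹ * (y * z)) := by
    rw [hS_eq, hwB, hwC, hy'', hz'', add_comm x z]
    field_simp
    rw [hσdef]
    ring
  have hB : S⁻¹ * wA * ((y + z)⁻¹ * z) + S⁻¹ * wC * ((x + y)⁻¹ * x)
      = 4⁻¹ * (1 + σ⁻¹ * (z * x)) := by
    rw [hS_eq, hwA, hwC, hx'', hz'']
    field_simp
    rw [hσdef]
    ring
  have hC : S⁻¹ * wA * ((y + z)⁻¹ * y) + S⁻¹ * wB * ((z + x)⁻¹ * x)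
      = 4⁻¹ * (1 + σ⁻¹ * (x * y)) := by
    rw [hS_eq, hwA, hwB, hx'', hy'', add_comm x z]
    field_simp
    rw [hσdef]
    ring
  linear_combination (norm := module) (-1 : ℝ) • (hA • A + hB • B + hC • C)
end

section
/- (Barycentric coordinates of the generalized orthocenter) Set x'' = xy + xz + yz − x², y'' = xy + xz + yz − y², z'' = xy + xz + yz − z², and let w_A = x·y''·z'', w_B = y·x''·z'', w_C = z·x''·y'', with Σ = w_A + w_B + w_C. Then Σ ≠ 0 and the generalized orthocenter satisfies H = (w_A•A + w_B•B + w_C•C)/Σ (affine combination). -/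
/-- An affine equivalence preserves affine combinations of three points. -/
theorem AffineEquiv.map_affine_combination_three {V W : Type*}
    [AddCommGroup V] [Module ℝ V] [AddCommGroup W] [Module ℝ W]
    (T : V ≃ᵃ[ℝ] W) (A B C : V) {a b c : ℝ} (h : a + b + c = 1) :
    T (a • A + b • B + c • C) = a • T A + b • T B + c • T C := by
  have hB : T B = T.linear (B - A) + T A := by simpa using T.map_vadd A (B - A)
  have hC : T C = T.linear (C - A) + T A := by simpa using T.map_vadd A (C - A)
  have hcomb : a • A + b • B + c • C = (b • (B - A) + c • (C - A)) +ᵥ A := by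
    obtain rfl : a = 1 - b - c := by linarith
    rw [vadd_eq_add]
    module
  rw [hcomb, T.map_vadd, hB, hC, vadd_eq_add, map_add, map_smul, map_smul]
  obtain rfl : a = 1 - b - c := by linarith
  module

/-- The point reflection in the midpoint of `B` and `C` sends `D` to `B + C - D`. -/
theorem Equiv.pointReflection_midpoint_eq {V : Type*} [AddCommGroup V] [Module ℝ V]
    (B C D : V) : Equiv.pointReflection (midpoint ℝ B C) D = B + C - D := by
  rw [Equiv.pointReflection_apply, midpoint_eq_smul_add, invOf_eq_inv,
    vsub_eq_sub, vadd_eq_add]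
  module

/-- **Barycentric coordinates of the generalized orthocenter.** With
`x'' = xy + xz + yz − x²` (etc.), `w_A = x·y''·z''`, `w_B = y·x''·z''`,
`w_C = z·x''·y''`, and `S = w_A + w_B + w_C`, one has `S ≠ 0` and
`H = (w_A•A + w_B•B + w_C•C)/S`. -/
theorem generalized_orthocenter_barycentric
    (A B C G P P' Q D E F D₀ E₀ F₀ D₃ E₃ F₃ : EuclideanSpace ℝ (Fin 2))
    (x y z σ : ℝ)
    (hABC : AffineIndependent ℝ ![A, B, C])
    (hG : G = (3 : ℝ)⁻¹ • (A + B + C))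
    (hsum : x + y + z = 1)
    (hx : x ≠ 0) (hy : y ≠ 0) (hz : z ≠ 0)
    (hyz : y + z ≠ 0) (hzx : z + x ≠ 0) (hxy : x + y ≠ 0)
    (hP : P = x • A + y • B + z • C)
    (hD : D = (y + z)⁻¹ • (y • B + z • C))
    (hE : E = (z + x)⁻¹ • (z • C + x • A))
    (hF : F = (x + y)⁻¹ • (x • A + y • B))
    (hD₀ : D₀ = midpoint ℝ B C) (hE₀ : E₀ = midpoint ℝ C A) (hF₀ : F₀ = midpoint ℝ A B)
    (hσdef : σ = x * y + y * z + z * x) (hσ : σ ≠ 0)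
    (hP' : P' = σ⁻¹ • ((y * z) • A + (z * x) • B + (x * y) • C))
    (hD₃ : D₃ = Equiv.pointReflection D₀ D)
    (hE₃ : E₃ = Equiv.pointReflection E₀ E)
    (hF₃ : F₃ = Equiv.pointReflection F₀ F)
    (hD₃E₃F₃ : AffineIndependent ℝ ![D₃, E₃, F₃])
    (hQ : Q = AffineMap.homothety G (-(1 / 2) : ℝ) P')
    (T : EuclideanSpace ℝ (Fin 2) ≃ᵃ[ℝ] EuclideanSpace ℝ (Fin 2))
    (hTA : T A = D₃) (hTB : T B = E₃) (hTC : T C = F₃)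
    (H : EuclideanSpace ℝ (Fin 2))
    (hH : H = AffineMap.homothety G (-2 : ℝ)
      (T.symm (AffineMap.homothety G (-(1 / 2) : ℝ) Q)))
    (x'' y'' z'' wA wB wC S : ℝ)
    (hx'' : x'' = x * y + x * z + y * z - x ^ 2)
    (hy'' : y'' = x * y + x * z + y * z - y ^ 2)
    (hz'' : z'' = x * y + x * z + y * z - z ^ 2)
    (hwA : wA = x * y'' * z'')
    (hwB : wB = y * x'' * z'')
    (hwC : wC = z * x'' * y'')
    (hS : S = wA + wB + wC) :
    S ≠ 0 ∧ H = S⁻¹ • (wA • A + wB • B + wC • C) := by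
  have hS' : S = 4 * σ * (x * y * z) := by
    subst hS hwA hwB hwC hx'' hy'' hz'' hσdef
    ring
  have hS0 : S ≠ 0 := by
    rw [hS']
    positivity
  refine ⟨hS0, ?_⟩
  set a : ℝ := (1 - S⁻¹ * wA) / 2 with ha
  set b : ℝ := (1 - S⁻¹ * wB) / 2 with hb
  set c : ℝ := (1 - S⁻¹ * wC) / 2 with hc
  have habc : a + b + c = 1 := by
    have h : S⁻¹ * (wA + wB + wC) = 1 := by rw [← hS, inv_mul_cancel₀ hS0]
    rw [ha, hb, hc]
    linarith
  -- The weights of `K Q` are `(σ + yz) / (4σ)` and its cyclic analogues.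
  have hA : b * ((z + x)⁻¹ * z) + c * ((x + y)⁻¹ * y) = (σ + y * z) / (4 * σ) := by
    rw [hb, hc, hS', hwB, hwC, hx'', hy'', hz'']
    field_simp
    rw [hσdef]
    ring
  have hB : a * ((y + z)⁻¹ * z) + c * ((x + y)⁻¹ * x) = (σ + z * x) / (4 * σ) := by
    rw [ha, hc, hS', hwA, hwC, hx'', hy'', hz'']
    field_simp
    rw [hσdef]
    ring
  have hC : a * ((y + z)⁻¹ * y) + b * ((z + x)⁻¹ * x) = (σ + x * y) / (4 * σ) := by
    rw [ha, hb, hS', hwA, hwB, hx'', hy'', hz'']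
    field_simp
    rw [hσdef]
    ring
  have hD₃' : D₃ = ((y + z)⁻¹ * z) • B + ((y + z)⁻¹ * y) • C := by
    rw [hD₃, hD₀, hD, Equiv.pointReflection_midpoint_eq]
    match_scalars <;> field_simp <;> ring
  have hE₃' : E₃ = ((z + x)⁻¹ * x) • C + ((z + x)⁻¹ * z) • A := by
    rw [hE₃, hE₀, hE, Equiv.pointReflection_midpoint_eq]
    match_scalars <;> field_simp <;> ring
  have hF₃' : F₃ = ((x + y)⁻¹ * y) • A + ((x + y)⁻¹ * x) • B := by
    rw [hF₃, hF₀, hF, Equiv.pointReflection_midpoint_eq]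
    match_scalars <;> field_simp <;> ring
  have hKQ : AffineMap.homothety G (-(1 / 2) : ℝ) Q = ((σ + y * z) / (4 * σ)) • A +
      ((σ + z * x) / (4 * σ)) • B + ((σ + x * y) / (4 * σ)) • C := by
    simp only [hQ, hP', hG, AffineMap.homothety_apply, vsub_eq_sub, vadd_eq_add]
    match_scalars <;> field_simp <;> ring
  have hT : T (a • A + b • B + c • C) = AffineMap.homothety G (-(1 / 2) : ℝ) Q := by
    rw [T.map_affine_combination_three A B C habc, hTA, hTB, hTC, hD₃', hE₃', hF₃', hKQ,
      ← hA, ← hB, ← hC]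
    module
  rw [hH, ← hT, T.symm_apply_apply, hG, AffineMap.homothety_apply, vsub_eq_sub, vadd_eq_add,
    ha, hb, hc]
  module
end

section
/- (Gergonne–Nagel–incenter case) The point T⁻¹(K(I)) equals the circumcenter of triangle ABC, and the point K⁻¹(T⁻¹(K(I))) equals the orthocenter of triangle ABC; that is, the generalized circumcenter and generalized orthocenter of the Gergonne point are the classical circumcenter and orthocenter. -/
open scoped RealInnerProductSpace in
/-- The point with barycentric coordinates `a²(b² + c² - a²) : b²(c² + a² - b²) : c²(a² + b² - c²)`
is equidistant from the first vertex and the second one. -/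
theorem dist_eq_dist_of_circumcenter_barycentric {V : Type*} [NormedAddCommGroup V]
    [InnerProductSpace ℝ V] {A B C O : V} {a b c S : ℝ} (hS : S ≠ 0)
    (ha : a = dist B C) (hb : b = dist C A) (hc : c = dist A B)
    (hSeq : S = (a + b + c) * (b + c - a) * (c + a - b) * (a + b - c))
    (hO : O - A = (b ^ 2 * (c ^ 2 + a ^ 2 - b ^ 2) / S) • (B - A) +
      (c ^ 2 * (a ^ 2 + b ^ 2 - c ^ 2) / S) • (C - A)) :
    dist B O = dist A O := by
  have hc' : ⟪B - A, B - A⟫ = c ^ 2 := by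
    rw [real_inner_self_eq_norm_sq, hc, dist_comm, dist_eq_norm]
  have hb' : ⟪C - A, C - A⟫ = b ^ 2 := by
    rw [real_inner_self_eq_norm_sq, hb, dist_eq_norm]
  have ha' : a ^ 2 = c ^ 2 - 2 * ⟪B - A, C - A⟫ + b ^ 2 := by
    rw [ha, dist_eq_norm, ← sub_sub_sub_cancel_right B C A, norm_sub_sq_real,
      ← real_inner_self_eq_norm_sq, ← real_inner_self_eq_norm_sq, hc', hb']
  have key : 2 * ⟪B - A, O - A⟫ = c ^ 2 := by
    have hr : ⟪B - A, C - A⟫ = (b ^ 2 + c ^ 2 - a ^ 2) / 2 := by linarith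
    rw [hO, inner_add_right, inner_smul_right, inner_smul_right, hc', hr]
    field_simp
    rw [hSeq]
    ring
  rw [dist_eq_norm, dist_comm A O, dist_eq_norm, ← sub_sub_sub_cancel_right B O A,
    ← sq_eq_sq₀ (norm_nonneg _) (norm_nonneg _), norm_sub_sq_real,
    ← real_inner_self_eq_norm_sq (B - A), hc']
  linarith

/-- The strict triangle inequality for a nondegenerate triangle. -/
theorem AffineIndependent.dist_lt_dist_add_dist {V : Type*} [NormedAddCommGroup V]
    [InnerProductSpace ℝ V] {A B C : V} (h : AffineIndependent ℝ ![A, B, C]) :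
    dist B C < dist C A + dist A B := by
  refine lt_of_le_of_ne ?_ fun heq => ?_
  · rw [dist_comm C A, dist_comm A B, add_comm]
    exact dist_triangle B A C
  · rw [affineIndependent_iff_not_collinear_set] at h
    have hw : Wbtw ℝ C A B := dist_add_dist_eq_iff.1 (by rw [← heq, dist_comm])
    apply h
    have := hw.collinear
    rwa [Set.insert_comm, Set.pair_comm C B] at this

/-- **Corollary 3.3 (Gergonne–Nagel–incenter case).** For the incenter `I` (the
isotomcomplement of the Gergonne point) and `T = T_{Na}` the affine map taking `ABC` to
the cevian triangle of the Nagel point, `T⁻¹(K(I))` is the circumcenter of `ABC` and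
`K⁻¹(T⁻¹(K(I)))` is the orthocenter of `ABC`. -/
theorem gergonne_generalized_circumcenter_orthocenter
    (A B C G I D₃ E₃ F₃ : EuclideanSpace ℝ (Fin 2))
    (a b c : ℝ)
    (hABC : AffineIndependent ℝ ![A, B, C])
    (hG : G = (3 : ℝ)⁻¹ • (A + B + C))
    (ha : a = dist B C) (hb : b = dist C A) (hc : c = dist A B)
    (hI : I = (a + b + c)⁻¹ • (a • A + b • B + c • C))
    (hD₃ : D₃ = (2 * a)⁻¹ • ((c + a - b) • B + (a + b - c) • C))
    (hE₃ : E₃ = (2 * b)⁻¹ • ((a + b - c) • C + (b + c - a) • A))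
    (hF₃ : F₃ = (2 * c)⁻¹ • ((b + c - a) • A + (c + a - b) • B))
    (hD₃E₃F₃ : AffineIndependent ℝ ![D₃, E₃, F₃])
    (T : EuclideanSpace ℝ (Fin 2) ≃ᵃ[ℝ] EuclideanSpace ℝ (Fin 2))
    (hTA : T A = D₃) (hTB : T B = E₃) (hTC : T C = F₃) :
    T.symm (AffineMap.homothety G (-(1 / 2) : ℝ) I) =
        (⟨![A, B, C], hABC⟩ : Affine.Triangle ℝ (EuclideanSpace ℝ (Fin 2))).circumcenter ∧
      AffineMap.homothety G (-2 : ℝ) (T.symm (AffineMap.homothety G (-(1 / 2) : ℝ) I)) =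
        Affine.Triangle.orthocenter (⟨![A, B, C], hABC⟩ : Affine.Triangle ℝ (EuclideanSpace ℝ (Fin 2))) := by
  have h2 : AffineIndependent ℝ ![B, C, A] := by
    rw [affineIndependent_iff_not_collinear_set] at hABC ⊢
    rwa [Set.pair_comm C A, Set.insert_comm]
  have h3 : AffineIndependent ℝ ![C, A, B] := by
    rw [affineIndependent_iff_not_collinear_set] at hABC ⊢
    rwa [Set.insert_comm, Set.pair_comm C B]
  have t1 := hABC.dist_lt_dist_add_dist
  have t2 := h2.dist_lt_dist_add_dist
  have t3 := h3.dist_lt_dist_add_dist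
  rw [← ha, ← hb, ← hc] at t1 t2 t3
  have pa : 0 < a := by linarith
  have pb : 0 < b := by linarith
  have pc : 0 < c := by linarith
  have n0 : a + b + c ≠ 0 := by positivity
  have n1 : b + c - a ≠ 0 := by linarith
  have n2 : c + a - b ≠ 0 := by linarith
  have n3 : a + b - c ≠ 0 := by linarith
  obtain ⟨S, hS⟩ : ∃ S, S = (a + b + c) * (b + c - a) * (c + a - b) * (a + b - c) := ⟨_, rfl⟩
  have hS0 : S ≠ 0 := by
    rw [hS]
    exact mul_ne_zero (mul_ne_zero (mul_ne_zero n0 n1) n2) n3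
  obtain ⟨O, hO⟩ : ∃ O : EuclideanSpace ℝ (Fin 2), O =
      (b ^ 2 * (c ^ 2 + a ^ 2 - b ^ 2) / S) • (B - A) +
      (c ^ 2 * (a ^ 2 + b ^ 2 - c ^ 2) / S) • (C - A) + A := ⟨_, rfl⟩
  have hBO : dist B O = dist A O :=
    dist_eq_dist_of_circumcenter_barycentric hS0 ha hb hc hS (by rw [hO, add_sub_cancel_right])
  have hCO : dist C O = dist A O :=
    dist_eq_dist_of_circumcenter_barycentric (a := a) (b := c) (c := b) (S := S) hS0
      (by rw [ha, dist_comm]) (by rw [hc, dist_comm]) (by rw [hb, dist_comm])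
      (by rw [hS]; ring) (by
        rw [hO, add_sub_cancel_right, add_comm]
        congr 3 <;> ring)
  have hcirc : O =
      (⟨![A, B, C], hABC⟩ : Affine.Triangle ℝ (EuclideanSpace ℝ (Fin 2))).circumcenter := by
    refine Affine.Simplex.eq_circumcenter_of_dist_eq (r := dist A O) _ ?_ ?_
    · have htop : affineSpan ℝ (Set.range ![A, B, C]) = ⊤ := by
        rw [hABC.affineSpan_eq_top_iff_card_eq_finrank_add_one]
        simp
      exact htop ▸ AffineSubspace.mem_top ℝ _ O
    · intro i
      fin_cases i
      exacts [rfl, hBO, hCO]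
  have hTO : T O = AffineMap.homothety G (-(1 / 2) : ℝ) I := by
    have hTB' : T.linear (B - A) = E₃ - D₃ := by
      rw [← hTA, ← hTB]
      exact T.toAffineMap.linearMap_vsub B A
    have hTC' : T.linear (C - A) = F₃ - D₃ := by
      rw [← hTA, ← hTC]
      exact T.toAffineMap.linearMap_vsub C A
    rw [hO, ← vadd_eq_add, AffineEquiv.map_vadd, map_add, map_smul, map_smul, hTB', hTC', hTA,
      hD₃, hE₃, hF₃, AffineMap.homothety_apply, hI, hG, hS]
    ext i
    simp only [vsub_eq_sub, vadd_eq_add, PiLp.add_apply, PiLp.sub_apply, PiLp.smul_apply,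
      smul_eq_mul]
    field_simp
    ring
  have hsymm : T.symm (AffineMap.homothety G (-(1 / 2) : ℝ) I) = O := by
    rw [← hTO, T.symm_apply_apply]
  rw [hsymm]
  refine ⟨hcirc, ?_⟩
  have hsum := Affine.Triangle.orthocenter_vsub_circumcenter_eq_sum_vsub
    (⟨![A, B, C], hABC⟩ : Affine.Triangle ℝ (EuclideanSpace ℝ (Fin 2)))
  rw [← hcirc, Fin.sum_univ_three] at hsum
  rw [← sub_add_cancel (Affine.Triangle.orthocenter _) O, ← vsub_eq_sub, hsum,
    AffineMap.homothety_apply, hG]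
  ext i
  simp
  ring
end
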